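/- arXiv:1306.5295 — 8 statements merged into one kernel-verified Lean document; each statement's English description precedes it below -/
import Mathlib

section
/- Let V be a real inner product space, let u, w ∈ V with ‖u‖ = 1, w ≠ 0, and ‖w − u‖ ≤ r for some r with 0 ≤ r ≤ 1. Then the angle between u and w is at most arcsin(r). -/
open Real InnerProductGeometry

theorem angle_le_arcsin_of_mem_ball {V : Type*} [NormedAddCommGroup V]
    [InnerProductSpace ℝ V] (u w : V) (r : ℝ)
    (hu : ‖u‖ = 1) (hw : w ≠ 0) (hr0 : 0 ≤ r) (hr1 : r ≤ 1)
    (hdist : ‖w - u‖ ≤ r) :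
    InnerProductGeometry.angle u w ≤ Real.arcsin r := by
  rw [Real.arcsin_eq_arccos hr0, InnerProductGeometry.angle]
  apply Real.arccos_le_arccos
  have hw_pos : 0 < ‖w‖ := norm_pos_iff.mpr hw
  rw [hu, one_mul, le_div_iff₀ hw_pos]
  have h_expand : ‖w - u‖ ^ 2 = ‖w‖ ^ 2 - 2 * inner ℝ u w + 1 := by
    rw [norm_sub_sq_real, hu, real_inner_comm, one_pow]
  have h_sq : ‖w - u‖ ^ 2 ≤ r ^ 2 := by gcongr
  have h_sqrt : √(1 - r ^ 2) ^ 2 = 1 - r ^ 2 := Real.sq_sqrt (by nlinarith)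
  nlinarith [sq_nonneg (‖w‖ - √(1 - r ^ 2))]
end

section
/- Let V be a real inner product space, u, w ∈ V with ‖u‖ = 1, w ≠ 0, and ‖w − u‖ ≤ r for some r with 0 ≤ r ≤ 1. Then ‖u − w/‖w‖‖ ≤ 2·sin((1/2)·arcsin(r)). -/
open Real InnerProductGeometry

theorem chord_to_normalization_le {V : Type*} [NormedAddCommGroup V]
    [InnerProductSpace ℝ V] (u w : V) (r : ℝ)
    (hu : ‖u‖ = 1) (hw : w ≠ 0) (hr0 : 0 ≤ r) (hr1 : r ≤ 1)
    (hdist : ‖w - u‖ ≤ r) :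
    ‖u - ‖w‖⁻¹ • w‖ ≤ 2 * Real.sin ((1 / 2) * Real.arcsin r) := by
  have hn : 0 < ‖w‖ := norm_pos_iff.mpr hw
  have hsin : 0 ≤ Real.sin ((1 / 2) * Real.arcsin r) := by
    have h0 := Real.arcsin_nonneg.mpr hr0
    have h1 := Real.arcsin_le_pi_div_two r
    exact Real.sin_nonneg_of_nonneg_of_le_pi (by linarith) (by linarith [Real.pi_pos])
  have hcos : (2 * Real.sin ((1 / 2) * Real.arcsin r)) ^ 2 = 2 - 2 * √(1 - r ^ 2) := by
    have h := Real.cos_two_mul ((1 / 2) * Real.arcsin r)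
    rw [show 2 * ((1 / 2) * Real.arcsin r) = Real.arcsin r by ring, Real.cos_arcsin,
      Real.cos_sq'] at h
    linarith
  have hs : √(1 - r ^ 2) ^ 2 = 1 - r ^ 2 := Real.sq_sqrt (by nlinarith)
  have hd : ‖w‖ ^ 2 - 2 * inner ℝ u w + 1 ≤ r ^ 2 := by
    have h := norm_sub_sq_real w u
    rw [hu, real_inner_comm] at h
    nlinarith [norm_nonneg (w - u)]
  have hc : √(1 - r ^ 2) ≤ ‖w‖⁻¹ * inner ℝ u w := by
    rw [inv_mul_eq_div, le_div_iff₀ hn]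
    nlinarith [sq_nonneg (‖w‖ - √(1 - r ^ 2))]
  refine (sq_le_sq₀ (norm_nonneg _) (by positivity)).mp ?_
  rw [hcos, norm_sub_sq_real, hu, inner_smul_right, norm_smul, norm_inv, norm_norm,
    inv_mul_cancel₀ hn.ne']
  linarith
end

section
/- Let u ∈ ℝ³ (as a Euclidean space) with ‖u‖ = 1, let c ≥ 0 with √3·c < 1, and let w ∈ ℝ³ satisfy |w_i − u_i| ≤ c for each coordinate i ∈ {1,2,3}. Then w ≠ 0 and ‖u − w/‖w‖‖ ≤ (5/2)·c. -/
open Real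

/-- If `u` is a unit vector and `w` lies at distance less than `1` from `u`, then normalizing `w`
increases the distance to `u` by a factor of at most `√2`. -/
lemma norm_sub_normalize_sq_le {E : Type*} [NormedAddCommGroup E] [InnerProductSpace ℝ E]
    {u w : E} (hu : ‖u‖ = 1) (h : ‖w - u‖ < 1) :
    ‖u - ‖w‖⁻¹ • w‖ ^ 2 ≤ 2 * ‖w - u‖ ^ 2 := by
  have hw : w ≠ 0 := by
    rintro rfl
    simp [hu] at h
  have hr : 0 < ‖w‖ := norm_pos_iff.mpr hw
  set v := ‖w‖⁻¹ • w with hv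
  have hv1 : ‖v‖ = 1 := by
    rw [hv, norm_smul, norm_inv, norm_norm, inv_mul_cancel₀ hr.ne']
  have hwv : w = ‖w‖ • v := by rw [hv, smul_inv_smul₀ hr.ne']
  have ht1 : inner ℝ u v ≤ 1 := by
    simpa [hu, hv1] using real_inner_le_norm u v
  have hwu : inner ℝ w u = ‖w‖ * inner ℝ u v := by
    conv_lhs => rw [hwv]
    rw [real_inner_smul_left, real_inner_comm]
  have hd := norm_sub_sq_real w u
  have hch := norm_sub_sq_real u v
  rw [hu, hwu] at hd
  rw [hu, hv1] at hch
  have hd1 : ‖w - u‖ ^ 2 < 1 := by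
    nlinarith [norm_nonneg (w - u)]
  have ht0 : 0 ≤ inner ℝ u v := by
    refine nonneg_of_mul_nonneg_right ?_ hr
    nlinarith [sq_nonneg ‖w‖]
  nlinarith [sq_nonneg (‖w‖ - inner ℝ u v), mul_nonneg ht0 (sub_nonneg.mpr ht1)]

lemma EuclideanSpace.norm_le_sqrt_card_mul {ι : Type*} [Fintype ι] (x : EuclideanSpace ℝ ι)
    {c : ℝ} (hc : 0 ≤ c) (hx : ∀ i, |x i| ≤ c) : ‖x‖ ≤ √(Fintype.card ι) * c := by
  rw [EuclideanSpace.norm_eq, ← Real.sqrt_sq hc, ← Real.sqrt_mul (Nat.cast_nonneg _)]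
  refine Real.sqrt_le_sqrt ?_
  calc ∑ i, ‖x i‖ ^ 2 ≤ ∑ _i : ι, c ^ 2 := by
        gcongr with i
        exact hx i
    _ = Fintype.card ι * c ^ 2 := by simp

theorem normalize_coordinatewise_approx
    (u w : EuclideanSpace ℝ (Fin 3)) (c : ℝ)
    (hu : ‖u‖ = 1) (hc : 0 ≤ c) (hc3 : Real.sqrt 3 * c < 1)
    (hw : ∀ i : Fin 3, |w i - u i| ≤ c) :
    w ≠ 0 ∧ ‖u - ‖w‖⁻¹ • w‖ ≤ (5 / 2) * c := by
  have hd : ‖w - u‖ ≤ √3 * c := by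
    simpa using EuclideanSpace.norm_le_sqrt_card_mul (w - u) hc hw
  have hd1 : ‖w - u‖ < 1 := hd.trans_lt hc3
  refine ⟨?_, ?_⟩
  · rintro rfl
    simp [hu] at hd1
  · refine (sq_le_sq₀ (norm_nonneg _) (by positivity)).mp ?_
    have hd2 : ‖w - u‖ ^ 2 ≤ 3 * c ^ 2 := by
      calc ‖w - u‖ ^ 2 ≤ (√3 * c) ^ 2 := by gcongr
        _ = 3 * c ^ 2 := by rw [mul_pow, Real.sq_sqrt (by norm_num)]
    nlinarith [norm_sub_normalize_sq_le hu hd1, sq_nonneg c]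
end

section
/- Let δ ∈ (0, 1], let u ∈ ℝ³ with ‖u‖ = 1, and let w ∈ ℝ³ satisfy |w_i − u_i| ≤ 2δ/5 for each coordinate i ∈ {1,2,3}. Then w ≠ 0 and ‖u − w/‖w‖‖ ≤ δ. -/
open Real

/-- If `w` is at distance at most `δ * √12 / 5` from a unit vector `u`, then the normalization
of `w` is at distance at most `δ` from `u`. -/
lemma norm_sub_normalize_le {E : Type*} [NormedAddCommGroup E] [InnerProductSpace ℝ E]
    {δ : ℝ} (hδ0 : 0 < δ) (hδ1 : δ ≤ 1) {u w : E} (hu : ‖u‖ = 1)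
    (h : ‖u - w‖ ^ 2 ≤ 12 * δ ^ 2 / 25) :
    w ≠ 0 ∧ ‖u - ‖w‖⁻¹ • w‖ ≤ δ := by
  have hδ2 : δ ^ 2 ≤ 1 := by nlinarith
  have hw0 : w ≠ 0 := by
    rintro rfl
    rw [sub_zero, hu] at h
    linarith
  refine ⟨hw0, ?_⟩
  have hn : 0 < ‖w‖ := norm_pos_iff.mpr hw0
  rw [norm_sub_sq_real, hu] at h
  have hinner : 1 - δ ^ 2 / 2 ≤ ‖w‖⁻¹ * inner ℝ u w := by
    rw [inv_mul_eq_div, le_div_iff₀ hn]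
    nlinarith [sq_nonneg (‖w‖ - (1 - δ ^ 2 / 2)), mul_nonneg (sq_nonneg δ) (sub_nonneg.mpr hδ2)]
  have hunit : ‖‖w‖⁻¹ • w‖ = 1 := by
    rw [norm_smul, norm_inv, norm_norm, inv_mul_cancel₀ hn.ne']
  refine (sq_le_sq₀ (norm_nonneg _) hδ0.le).mp ?_
  rw [norm_sub_sq_real, hu, hunit, real_inner_smul_right]
  linarith

theorem twoED_noiseless_accuracy (δ : ℝ) (hδ : δ ∈ Set.Ioc (0:ℝ) 1)
    (u w : EuclideanSpace ℝ (Fin 3)) (hu : ‖u‖ = 1)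
    (hw : ∀ i : Fin 3, |w i - u i| ≤ 2 * δ / 5) :
    w ≠ 0 ∧ ‖u - ‖w‖⁻¹ • w‖ ≤ δ := by
  refine norm_sub_normalize_le hδ.1 hδ.2 hu ?_
  have hsq (i : Fin 3) : (w i - u i) ^ 2 ≤ (2 * δ / 5) ^ 2 :=
    sq_le_sq' (abs_le.mp (hw i)).1 (abs_le.mp (hw i)).2
  rw [norm_sub_rev, EuclideanSpace.real_norm_sq_eq, Fin.sum_univ_three]
  simp only [PiLp.sub_apply]
  linarith [hsq 0, hsq 1, hsq 2]
end

section
/- Let (X, d) be a metric space, m, t ∈ ℕ with 3t < m, and δ ≥ 0. Let C ⊆ Fin m (the correct nodes) with |Fin m \ C| ≤ t. Let w : Fin m → X and a : Fin m → Fin m → X satisfy d(a i j, w j) ≤ δ for all i, j ∈ C. For each i define S i = { j ∈ Fin m : d(w i, a i j) ≤ 3δ }. Then for all i, j ∈ C with |S i| ≥ m − t and |S j| ≥ m − t, we have d(w i, w j) ≤ 8δ. -/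
theorem weak_consensus_consistency {X : Type*} [MetricSpace X]
    (m t : ℕ) (hmt : 3 * t < m) (δ : ℝ) (hδ : 0 ≤ δ)
    (C : Finset (Fin m)) (hC : (Finset.univ \ C).card ≤ t)
    (w : Fin m → X) (a : Fin m → Fin m → X)
    (ha : ∀ i ∈ C, ∀ j ∈ C, dist (a i j) (w j) ≤ δ)
    (S : Fin m → Set (Fin m))
    (hS : ∀ i, S i = {j : Fin m | dist (w i) (a i j) ≤ 3 * δ}) :
    ∀ i ∈ C, ∀ j ∈ C, m - t ≤ (S i).ncard → m - t ≤ (S j).ncard →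
      dist (w i) (w j) ≤ 8 * δ := by
  intro i hi j hj hSi hSj
  obtain ⟨k, hkC, hki, hkj⟩ : ∃ k ∈ C, k ∈ S i ∧ k ∈ S j := by
    by_contra! hne
    have hcover : (Set.univ : Set (Fin m)) ⊆
        ((Finset.univ \ C : Finset (Fin m)) : Set (Fin m)) ∪ ((S i)ᶜ ∪ (S j)ᶜ) := by
      intro k _
      have hk := hne k
      simp only [Set.mem_union, Finset.mem_coe, Finset.mem_sdiff, Finset.mem_univ, true_and,
        Set.mem_compl_iff]
      tauto
    have hle := Set.ncard_le_ncard hcover (Set.toFinite _)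
    have hunion := Set.ncard_union_le
      ((Finset.univ \ C : Finset (Fin m)) : Set (Fin m)) ((S i)ᶜ ∪ (S j)ᶜ)
    have hunion' := Set.ncard_union_le (S i)ᶜ (S j)ᶜ
    have hci := Set.ncard_add_ncard_compl (S i)
    have hcj := Set.ncard_add_ncard_compl (S j)
    rw [Set.ncard_coe_finset] at hunion
    rw [Set.ncard_univ, Nat.card_fin] at hle
    rw [Nat.card_fin] at hci hcj
    omega
  rw [hS, Set.mem_ofPred_eq] at hki hkj
  have hik := ha i hi k hkC
  have hjk := ha j hj k hkC
  have hwi := dist_triangle (w i) (a i k) (w k)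
  have hwj := dist_triangle (w j) (a j k) (w k)
  have hij := dist_triangle_right (w i) (w j) (w k)
  linarith
end

section
/- Let (X, d) be a metric space, m, t ∈ ℕ with 3t < m, and δ ≥ 0. Let C ⊆ Fin m (the correct nodes) with |Fin m \ C| ≤ t and |C| ≥ m − t. Let w : Fin m → X and a : Fin m → Fin m → X satisfy d(a i j, w j) ≤ δ for all i, j ∈ C. Suppose there exists s ∈ X with d(s, w i) ≤ δ for all i ∈ C. For each i define S i = { j ∈ Fin m : d(w i, a i j) ≤ 3δ }. Then for every i ∈ C, C ⊆ S i and hence |S i| ≥ m − t (so every correct node outputs its input w i, which satisfies d(s, w i) ≤ δ). -/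
theorem weak_consensus_persistency {X : Type*} [MetricSpace X]
    (m t : ℕ) (hmt : 3 * t < m) (δ : ℝ) (hδ : 0 ≤ δ)
    (C : Finset (Fin m)) (hCf : (Finset.univ \ C).card ≤ t)
    (hCcard : m - t ≤ C.card)
    (w : Fin m → X) (a : Fin m → Fin m → X)
    (ha : ∀ i ∈ C, ∀ j ∈ C, dist (a i j) (w j) ≤ δ)
    (s : X) (hs : ∀ i ∈ C, dist s (w i) ≤ δ)
    (S : Fin m → Set (Fin m))
    (hS : ∀ i, S i = {j : Fin m | dist (w i) (a i j) ≤ 3 * δ}) :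
    ∀ i ∈ C, (↑C : Set (Fin m)) ⊆ S i ∧ m - t ≤ (S i).ncard := by
  intro i hi
  have hsub : (↑C : Set (Fin m)) ⊆ S i := by
    intro j hj
    rw [hS]
    calc dist (w i) (a i j)
        ≤ dist (w i) s + dist s (w j) + dist (w j) (a i j) := dist_triangle4 _ _ _ _
      _ ≤ δ + δ + δ := by
          rw [dist_comm (w i) s, dist_comm (w j) (a i j)]
          exact add_le_add (add_le_add (hs i hi) (hs j hj)) (ha i hi j hj)
      _ = 3 * δ := by ring
  refine ⟨hsub, hCcard.trans ?_⟩
  rw [← Set.ncard_coe_finset C]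
  exact Set.ncard_le_ncard hsub (Set.toFinite _)
end

section
/- Let (X, d) be a metric space, m, t ∈ ℕ with 3t < m, and δ ≥ 0. Let C ⊆ Fin m (the correct nodes) with |Fin m \ C| ≤ t and |C| ≥ m − t. Let s ∈ X, w : Fin m → X with d(s, w i) ≤ δ for all i ∈ C, and a : Fin m → Fin m → X with d(a i j, w j) ≤ δ for all i, j ∈ C. For i, j ∈ Fin m define T i j = { k ∈ Fin m : d(a i j, a i k) ≤ 10δ }. Then for all i, j ∈ C: C ⊆ T i j, and hence |T i j| ≥ m − t. -/
theorem graded_consensus_persistency_sets {X : Type*} [MetricSpace X]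
    (m t : ℕ) (hmt : 3 * t < m) (δ : ℝ) (hδ : 0 ≤ δ)
    (C : Finset (Fin m)) (hCf : (Finset.univ \ C).card ≤ t)
    (hCcard : m - t ≤ C.card)
    (s : X) (w : Fin m → X) (hs : ∀ i ∈ C, dist s (w i) ≤ δ)
    (a : Fin m → Fin m → X)
    (ha : ∀ i ∈ C, ∀ j ∈ C, dist (a i j) (w j) ≤ δ)
    (T : Fin m → Fin m → Set (Fin m))
    (hT : ∀ i j, T i j = {k : Fin m | dist (a i j) (a i k) ≤ 10 * δ}) :
    ∀ i ∈ C, ∀ j ∈ C, (↑C : Set (Fin m)) ⊆ T i j ∧ m - t ≤ (T i j).ncard := by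
  intro i hi j hj
  have hsub : (↑C : Set (Fin m)) ⊆ T i j := by
    intro k hk
    rw [hT, Set.mem_ofPred_eq]
    have hwj := hs j hj
    rw [dist_comm] at hwj
    have hak := ha i hi k hk
    rw [dist_comm] at hak
    have hleft := dist_triangle4 (a i j) (w j) s (w k)
    have hright := dist_triangle (a i j) (w k) (a i k)
    linarith [ha i hi j hj, hs k hk]
  refine ⟨hsub, hCcard.trans ?_⟩
  rw [← Set.ncard_coe_finset]
  exact Set.ncard_le_ncard hsub (Set.toFinite _)
end

section
/- Let (X, d) be a metric space, m, t ∈ ℕ with 3t < m, and δ ≥ 0. Let C ⊆ Fin m (the correct nodes) with |Fin m \ C| ≤ t, and let G ⊆ C (the correct nodes with flag 1). Let u : Fin m → X satisfy d(u α, u β) ≤ 8δ for all α, β ∈ G, and let a : Fin m → Fin m → X satisfy d(a i k, u k) ≤ δ for all i ∈ C and k ∈ G. Let F : Fin m → Fin m → Prop (the flags as received) satisfy: for all i ∈ C and k ∈ C, F i k holds if and only if k ∈ G. For i, j ∈ Fin m define T i j = { k ∈ Fin m : F i k and d(a i j, a i k) ≤ 10δ }. Let l : Fin m → Fin m satisfy,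 for every i ∈ C: F i (l i) holds and |T i (l i)| ≥ |T i j| for every j with F i j. Define v : Fin m → X by v i = u i if i ∈ G and v i = a i (l i) otherwise. If there exists i₀ ∈ C with |T i₀ (l i₀)| ≥ m − t, then for all i, j ∈ C, d(v i, v j) ≤ 30δ. -/
theorem graded_consensus_consistency {X : Type*} [MetricSpace X]
    (m t : ℕ) (hmt : 3 * t < m) (δ : ℝ) (hδ : 0 ≤ δ)
    (C : Finset (Fin m)) (hCf : (Finset.univ \ C).card ≤ t)
    (G : Finset (Fin m)) (hGC : G ⊆ C)
    (u : Fin m → X)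
    (hu : ∀ α ∈ G, ∀ β ∈ G, dist (u α) (u β) ≤ 8 * δ)
    (a : Fin m → Fin m → X)
    (ha : ∀ i ∈ C, ∀ k ∈ G, dist (a i k) (u k) ≤ δ)
    (F : Fin m → Fin m → Prop)
    (hF : ∀ i ∈ C, ∀ k ∈ C, (F i k ↔ k ∈ G))
    (T : Fin m → Fin m → Set (Fin m))
    (hT : ∀ i j, T i j = {k : Fin m | F i k ∧ dist (a i j) (a i k) ≤ 10 * δ})
    (l : Fin m → Fin m)
    (hl : ∀ i ∈ C, F i (l i) ∧ ∀ j : Fin m, F i j → (T i j).ncard ≤ (T i (l i)).ncard)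
    (v : Fin m → X)
    (hv : ∀ i : Fin m, v i = if i ∈ G then u i else a i (l i))
    (hking : ∃ i₀ ∈ C, m - t ≤ (T i₀ (l i₀)).ncard) :
    ∀ i ∈ C, ∀ j ∈ C, dist (v i) (v j) ≤ 30 * δ := by
  classical
  have hT_sub : ∀ i ∈ C, ∀ j, T i j ⊆ ↑(G ∪ (Finset.univ \ C)) := by
    intro i hi j k hk
    rw [hT] at hk
    by_cases hkC : k ∈ C
    · simp [(hF i hi k hkC).1 hk.1]
    · simp [hkC]
  have hG_card : t < G.card := by
    obtain ⟨i₀, hi₀, hcard⟩ := hking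
    have h := Set.ncard_le_ncard (hT_sub i₀ hi₀ (l i₀)) (Finset.finite_toSet _)
    rw [Set.ncard_coe_finset] at h
    have := Finset.card_union_le G (Finset.univ \ C)
    omega
  obtain ⟨g, hg⟩ : G.Nonempty := Finset.card_pos.1 (by omega)
  have h_close : ∀ i ∈ C, ∃ k ∈ G, dist (v i) (u k) ≤ 11 * δ := by
    intro i hi
    by_cases hiG : i ∈ G
    · exact ⟨i, hiG, by rw [hv, if_pos hiG, dist_self]; positivity⟩
    have hG_sub : (↑G : Set (Fin m)) ⊆ T i g := by
      intro k hk
      have hkG : k ∈ G := hk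
      rw [hT]
      refine ⟨(hF i hi k (hGC hkG)).2 hkG, ?_⟩
      have h₁ := dist_triangle4 (a i g) (u g) (u k) (a i k)
      have h₂ := ha i hi k hkG
      rw [dist_comm] at h₂
      linarith [ha i hi g hg, hu g hg k hkG]
    have h_card : t < (T i (l i)).ncard := by
      have h := Set.ncard_le_ncard hG_sub (Set.toFinite _)
      rw [Set.ncard_coe_finset] at h
      exact hG_card.trans_le (h.trans ((hl i hi).2 g ((hF i hi g (hGC hg)).2 hg)))
    obtain ⟨k, hkT, hkG⟩ : ∃ k ∈ T i (l i), k ∈ G := by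
      by_contra! hne
      have h_sub : T i (l i) ⊆ ↑(Finset.univ \ C) := fun k hk =>
        (Finset.mem_union.1 (hT_sub i hi _ hk)).resolve_left (hne k hk)
      have h := Set.ncard_le_ncard h_sub (Finset.finite_toSet _)
      rw [Set.ncard_coe_finset] at h
      omega
    refine ⟨k, hkG, ?_⟩
    rw [hT] at hkT
    rw [hv, if_neg hiG]
    linarith [dist_triangle (a i (l i)) (a i k) (u k), hkT.2, ha i hi k hkG]
  intro i hi j hj
  obtain ⟨k, hk, hik⟩ := h_close i hi
  obtain ⟨k', hk', hjk⟩ := h_close j hj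
  rw [dist_comm] at hjk
  linarith [dist_triangle4 (v i) (u k) (u k') (v j), hu k hk k' hk']
end
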